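/- Let n ≥ 1, p > 1, q = p/(p-1), and let f be a nonnegative measurable function on ℝⁿ with f ∈ L^p(ℝⁿ). Then, with |·| the Euclidean norm, (∫_{ℝⁿ} (∫_{ℝⁿ} (f(x)/(|x| + |y|)) |x|^{(1−n)/q} dx)^p |y|^{1−n} dy)^{1/p} ≤ (nπ/sin(π/p)) · (π^{n/2}/Γ(n/2 + 1)) · (∫_{ℝⁿ} f(x)^p dx)^{1/p}. -/

import Mathlib

open MeasureTheory Set ENNReal

theorem lintegral_fun_norm_addHaar {E : Type*} [NormedAddCommGroup E] [NormedSpace ℝ E]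
    [FiniteDimensional ℝ E] [Nontrivial E] [MeasurableSpace E] [BorelSpace E]
    (μ : Measure E) [μ.IsAddHaarMeasure] {f : ℝ → ℝ≥0∞} (hf : Measurable f) :
    ∫⁻ x, f ‖x‖ ∂μ = Module.finrank ℝ E * μ (Metric.ball 0 1) *
      ∫⁻ r in Ioi (0 : ℝ), ENNReal.ofReal (r ^ (Module.finrank ℝ E - 1)) * f r :=
  calc
    ∫⁻ x, f ‖x‖ ∂μ = ∫⁻ x : ({(0)}ᶜ : Set E), f (‖x.1‖) ∂(μ.comap (↑)) := by
      rw [lintegral_subtype_comap (measurableSet_singleton _).compl fun x ↦ f ‖x‖,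
        restrict_compl_singleton]
    _ = ∫⁻ x, f x.2 ∂μ.toSphere.prod (.volumeIoiPow (Module.finrank ℝ E - 1)) := by
      simpa using (μ.measurePreserving_homeomorphUnitSphereProd.lintegral_comp_emb
        (Homeomorph.measurableEmbedding _) (f ∘ Subtype.val ∘ Prod.snd))
    _ = μ.toSphere univ * ∫⁻ r : Ioi (0 : ℝ), f r ∂.volumeIoiPow (Module.finrank ℝ E - 1) := by
      rw [lintegral_prod _ (by fun_prop)]
      simp only [lintegral_const, mul_comm]
    _ = _ := by
      rw [μ.toSphere_apply_univ, Measure.volumeIoiPow,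
        lintegral_withDensity_eq_lintegral_mul _ (by fun_prop) (by fun_prop)]
      congr 1
      exact lintegral_subtype_comap measurableSet_Ioi
        fun r ↦ ENNReal.ofReal (r ^ (Module.finrank ℝ E - 1)) * f r

theorem lintegral_rpow_mul_exp_neg_mul_Ioi {b c : ℝ} (hb : 0 < b) (hc : 0 < c) :
    ∫⁻ t in Ioi (0 : ℝ), ENNReal.ofReal (t ^ (b - 1) * Real.exp (-(c * t))) =
      ENNReal.ofReal ((1 / c) ^ b * Real.Gamma b) := by
  have key := Real.integral_rpow_mul_exp_neg_mul_Ioi hb hc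
  have hpos : 0 < (1 / c) ^ b * Real.Gamma b := by
    have := Real.Gamma_pos_of_pos hb
    positivity
  rw [← key, ofReal_integral_eq_lintegral_ofReal]
  · by_contra h
    rw [← key, integral_undef h] at hpos
    exact hpos.false
  · filter_upwards [ae_restrict_mem measurableSet_Ioi] with t (ht : 0 < t)
    simp only [Pi.zero_apply]
    positivity

theorem lintegral_rpow_neg_div_add_Ioi {a s : ℝ} (ha₀ : 0 < a) (ha₁ : a < 1) (hs : 0 < s) :
    ∫⁻ r in Ioi (0 : ℝ), ENNReal.ofReal (r ^ (-a) / (r + s)) =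
      ENNReal.ofReal (Real.pi / Real.sin (Real.pi * a) * s ^ (-a)) := by
  calc
    _ = ∫⁻ r in Ioi (0 : ℝ), ∫⁻ t in Ioi (0 : ℝ),
          ENNReal.ofReal (r ^ (-a) * Real.exp (-((r + s) * t))) := by
      refine setLIntegral_congr_fun measurableSet_Ioi fun r (hr : 0 < r) ↦ ?_
      have h := lintegral_rpow_mul_exp_neg_mul_Ioi one_pos (add_pos hr hs)
      simp only [sub_self, Real.rpow_zero, one_mul, Real.rpow_one, Real.Gamma_one, mul_one] at h
      simp_rw [ENNReal.ofReal_mul (Real.rpow_nonneg hr.le (-a))]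
      rw [lintegral_const_mul _ (by fun_prop), h, ← ENNReal.ofReal_mul (by positivity),
        mul_one_div]
    _ = ∫⁻ t in Ioi (0 : ℝ), ∫⁻ r in Ioi (0 : ℝ),
          ENNReal.ofReal (r ^ (-a) * Real.exp (-((r + s) * t))) :=
      lintegral_lintegral_swap (by fun_prop)
    _ = ∫⁻ t in Ioi (0 : ℝ), ENNReal.ofReal (Real.Gamma (1 - a)) *
          ENNReal.ofReal (t ^ (a - 1) * Real.exp (-(s * t))) := by
      refine setLIntegral_congr_fun measurableSet_Ioi fun t (ht : 0 < t) ↦ ?_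
      have h := lintegral_rpow_mul_exp_neg_mul_Ioi (sub_pos.2 ha₁) ht
      rw [show 1 - a - 1 = -a by ring] at h
      have hsplit (r : ℝ) : r ^ (-a) * Real.exp (-((r + s) * t)) =
          Real.exp (-(s * t)) * (r ^ (-a) * Real.exp (-(t * r))) := by
        rw [show -((r + s) * t) = -(s * t) + -(t * r) by ring, Real.exp_add]
        ring
      simp_rw [hsplit, ENNReal.ofReal_mul (Real.exp_pos _).le]
      have hg := Real.Gamma_pos_of_pos (sub_pos.2 ha₁)
      rw [lintegral_const_mul _ (by fun_prop), h, ← ENNReal.ofReal_mul (by positivity),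
        ← ENNReal.ofReal_mul (by positivity), one_div, Real.inv_rpow ht.le, ← Real.rpow_neg ht.le,
        neg_sub]
      ring_nf
    _ = _ := by
      rw [lintegral_const_mul _ (by fun_prop), lintegral_rpow_mul_exp_neg_mul_Ioi ha₀ hs,
        ← ENNReal.ofReal_mul (Real.Gamma_pos_of_pos (sub_pos.2 ha₁)).le,
        ← Real.Gamma_mul_Gamma_one_sub, one_div, Real.inv_rpow hs.le, ← Real.rpow_neg hs.le]
      ring_nf

/-- **Schur test** for the boundedness on `L^p` of the integral operator with kernel `K`, with
test functions `u` and `v`. -/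
theorem lintegral_rpow_lintegral_mul_le_of_schur {X Y : Type*} [MeasurableSpace X]
    [MeasurableSpace Y] {μ : Measure X} {ν : Measure Y} [SFinite μ] [SFinite ν] {p q : ℝ}
    (hpq : p.HolderConjugate q) {K : X → Y → ℝ≥0∞} (hK : Measurable (Function.uncurry K))
    {u : X → ℝ≥0∞} {v : Y → ℝ≥0∞} (hu : Measurable u) (hv : Measurable v)
    (hu₀ : ∀ᵐ x ∂μ, u x ≠ 0) (hu_top : ∀ᵐ x ∂μ, u x ≠ ∞) {A B : ℝ≥0∞}
    (hA : ∀ᵐ y ∂ν, ∫⁻ x, K x y * u x ^ q ∂μ ≤ A * v y ^ q)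
    (hB : ∀ᵐ x ∂μ, ∫⁻ y, K x y * v y ^ p ∂ν ≤ B * u x ^ p)
    {g : X → ℝ≥0∞} (hg : Measurable g) :
    ∫⁻ y, (∫⁻ x, K x y * g x ∂μ) ^ p ∂ν ≤ A ^ (p / q) * B * ∫⁻ x, g x ^ p ∂μ := by
  have hp := hpq.pos
  have hq := hpq.symm.pos
  have hKx (y : Y) : Measurable (K · y) := hK.comp (measurable_id.prodMk measurable_const)
  have hKy (x : X) : Measurable (K x) := hK.comp (measurable_const.prodMk measurable_id)
  have holder (y : Y) : ∫⁻ x, K x y * g x ∂μ ≤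
      (∫⁻ x, K x y * u x ^ q ∂μ) ^ (1 / q) *
        (∫⁻ x, K x y * (g x / u x) ^ p ∂μ) ^ (1 / p) := by
    have h := ENNReal.lintegral_mul_le_Lp_mul_Lq μ hpq.symm
      (f := fun x ↦ K x y ^ (1 / q) * u x) (g := fun x ↦ K x y ^ (1 / p) * (g x / u x))
      (by have := hKx y; fun_prop) (by have := hKx y; fun_prop)
    simp only [Pi.mul_apply, ENNReal.mul_rpow_of_nonneg _ _ hp.le,
      ENNReal.mul_rpow_of_nonneg _ _ hq.le, ← ENNReal.rpow_mul, one_div_mul_cancel hp.ne',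
      one_div_mul_cancel hq.ne', ENNReal.rpow_one] at h
    refine (lintegral_congr_ae ?_).trans_le h
    filter_upwards [hu₀, hu_top] with x h0 ht
    rw [mul_mul_mul_comm, ← ENNReal.rpow_add_of_nonneg _ _ (by positivity) (by positivity),
      ENNReal.mul_div_cancel h0 ht, one_div, one_div, hpq.symm.inv_add_inv_eq_one,
      ENNReal.rpow_one]
  calc
    _ ≤ ∫⁻ y, A ^ (p / q) * ∫⁻ x, (g x / u x) ^ p * (K x y * v y ^ p) ∂μ ∂ν := by
      refine lintegral_mono_ae ?_
      filter_upwards [hA] with y hy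
      calc
        _ ≤ ((A * v y ^ q) ^ (1 / q) * (∫⁻ x, K x y * (g x / u x) ^ p ∂μ) ^ (1 / p)) ^ p := by
          gcongr
          exact (holder y).trans (by gcongr)
        _ = A ^ (p / q) * (v y ^ p * ∫⁻ x, K x y * (g x / u x) ^ p ∂μ) := by
          rw [ENNReal.mul_rpow_of_nonneg _ _ hp.le, ← ENNReal.rpow_mul, ← ENNReal.rpow_mul,
            one_div_mul_cancel hp.ne', ENNReal.rpow_one, one_div_mul_eq_div,
            ENNReal.mul_rpow_of_nonneg _ _ (by positivity), ← ENNReal.rpow_mul,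
            mul_div_cancel₀ _ hq.ne', mul_assoc]
        _ = _ := by
          rw [← lintegral_const_mul _ (by have := hKx y; fun_prop)]
          congr 1
          exact lintegral_congr fun x ↦ by ring
    _ = A ^ (p / q) * ∫⁻ x, (g x / u x) ^ p * ∫⁻ y, K x y * v y ^ p ∂ν ∂μ := by
      have hm : Measurable fun z : X × Y ↦ (g z.1 / u z.1) ^ p * (K z.1 z.2 * v z.2 ^ p) := by
        have : Measurable fun z : X × Y ↦ K z.1 z.2 := hK
        fun_prop
      rw [lintegral_const_mul _ hm.lintegral_prod_left', lintegral_lintegral_swap]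
      · congr 1
        exact lintegral_congr fun x ↦
          lintegral_const_mul ((g x / u x) ^ p) (f := fun y ↦ K x y * v y ^ p)
            ((hKy x).mul (hv.pow_const p))
      · exact (hm.comp measurable_swap).aemeasurable
    _ ≤ A ^ (p / q) * ∫⁻ x, B * g x ^ p ∂μ := by
      gcongr A ^ (p / q) * ?_
      refine lintegral_mono_ae ?_
      filter_upwards [hB, hu₀, hu_top] with x hx h0 ht
      calc
        _ ≤ (g x / u x) ^ p * (B * u x ^ p) := by gcongr
        _ = B * (g x / u x * u x) ^ p := by
          rw [ENNReal.mul_rpow_of_nonneg _ _ hp.le]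
          ring
        _ = _ := by rw [ENNReal.div_mul_cancel h0 ht]
    _ = _ := by rw [lintegral_const_mul _ (by fun_prop), mul_assoc]

theorem lintegral_inv_norm_add_mul_norm_rpow {E : Type*} [NormedAddCommGroup E] [NormedSpace ℝ E]
    [FiniteDimensional ℝ E] [Nontrivial E] [MeasurableSpace E] [BorelSpace E]
    (μ : Measure E) [μ.IsAddHaarMeasure] {a s : ℝ} (ha₀ : 0 < a) (ha₁ : a < 1) (hs : 0 < s) :
    ∫⁻ x, (ENNReal.ofReal (‖x‖ + s))⁻¹ * ENNReal.ofReal (‖x‖ ^ (-a))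
        ∂μ.withDensity (fun x ↦ ENNReal.ofReal (‖x‖ ^ (1 - (Module.finrank ℝ E : ℝ)))) =
      Module.finrank ℝ E * μ (Metric.ball 0 1) *
        ENNReal.ofReal (Real.pi / Real.sin (Real.pi * a)) * ENNReal.ofReal (s ^ (-a)) := by
  have hd : 1 ≤ Module.finrank ℝ E := Module.finrank_pos
  rw [lintegral_withDensity_eq_lintegral_mul _ (by fun_prop) (by fun_prop)]
  refine (lintegral_fun_norm_addHaar μ (f := fun r ↦
    ENNReal.ofReal (r ^ (1 - (Module.finrank ℝ E : ℝ))) *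
      ((ENNReal.ofReal (r + s))⁻¹ * ENNReal.ofReal (r ^ (-a)))) (by fun_prop)).trans ?_
  have hsin : 0 ≤ Real.pi / Real.sin (Real.pi * a) := by
    rw [← Real.Gamma_mul_Gamma_one_sub]
    exact mul_nonneg (Real.Gamma_pos_of_pos ha₀).le (Real.Gamma_pos_of_pos (sub_pos.2 ha₁)).le
  rw [mul_assoc _ (ENNReal.ofReal _), ← ENNReal.ofReal_mul hsin,
    ← lintegral_rpow_neg_div_add_Ioi ha₀ ha₁ hs]
  congr 1
  refine setLIntegral_congr_fun measurableSet_Ioi fun r (hr : 0 < r) ↦ ?_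
  rw [← ENNReal.ofReal_inv_of_pos (by positivity), ← ENNReal.ofReal_mul (by positivity),
    ← ENNReal.ofReal_mul (by positivity), ← ENNReal.ofReal_mul (by positivity), ← mul_assoc,
    ← Real.rpow_natCast, ← Real.rpow_add hr, Nat.cast_sub hd, Nat.cast_one,
    sub_add_sub_cancel, sub_self, Real.rpow_zero, one_mul, inv_mul_eq_div]

/-- Hardy-type integral inequality on `ℝⁿ` with the Euclidean norm:
`(∫ (∫ (f(x)/(|x|+|y|)) |x|^{(1−n)/q} dx)^p |y|^{1−n} dy)^{1/p}
  ≤ (nπ/sin(π/p)) (π^{n/2}/Γ(n/2+1)) ‖f‖_p`. -/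
theorem stmt_12 (n : ℕ) (hn : 1 ≤ n) (p q : ℝ) (hp : 1 < p) (hq : q = p / (p - 1))
    (f : EuclideanSpace ℝ (Fin n) → ℝ≥0∞) (hf : Measurable f)
    (hfp : ∫⁻ x, f x ^ p < ⊤) :
    (∫⁻ y : EuclideanSpace ℝ (Fin n), (∫⁻ x, f x / ENNReal.ofReal (‖x‖ + ‖y‖) *
          ENNReal.ofReal (‖x‖ ^ ((1 - (n : ℝ)) / q))) ^ p *
        ENNReal.ofReal (‖y‖ ^ (1 - (n : ℝ)))) ^ (1 / p) ≤
      ENNReal.ofReal ((n * Real.pi / Real.sin (Real.pi / p)) *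
          (Real.pi ^ ((n : ℝ) / 2) / Real.Gamma ((n : ℝ) / 2 + 1))) *
        (∫⁻ x, f x ^ p) ^ (1 / p) := by
  have : NeZero n := ⟨by omega⟩
  have hpq : p.HolderConjugate q := by
    rw [hq]
    exact Real.HolderConjugate.conjExponent hp
  have hp₀ := hpq.pos
  have hq₀ := hpq.symm.pos
  have hinv : 1 / p + 1 / q = 1 := by simpa using hpq.inv_add_inv_eq_one
  have hp_inv : 0 < 1 / p := by positivity
  have hq_inv : 0 < 1 / q := by positivity
  set w : EuclideanSpace ℝ (Fin n) → ℝ≥0∞ := fun x ↦ ENNReal.ofReal (‖x‖ ^ (1 - (n : ℝ)))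
  have hw : Measurable w := by fun_prop
  set μ : Measure (EuclideanSpace ℝ (Fin n)) := volume.withDensity w
  set C : ℝ≥0∞ := ENNReal.ofReal ((n * Real.pi / Real.sin (Real.pi / p)) *
    (Real.pi ^ ((n : ℝ) / 2) / Real.Gamma ((n : ℝ) / 2 + 1))) with hC
  have hne : ∀ᵐ x : EuclideanSpace ℝ (Fin n), x ≠ 0 := by simp [ae_iff]
  have hneμ : ∀ᵐ x ∂μ, x ≠ 0 := withDensity_absolutelyContinuous _ _ hne
  have hsin : 0 < Real.sin (Real.pi / p) :=
    Real.sin_pos_of_pos_of_lt_pi (by positivity) (div_lt_self Real.pi_pos hp)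
  have hsin_conj : Real.sin (Real.pi / q) = Real.sin (Real.pi / p) := by
    rw [← Real.sin_pi_sub, div_eq_mul_one_div, ← mul_one_sub,
      ← eq_sub_of_add_eq hinv, ← div_eq_mul_one_div]
  have radial {a s : ℝ} (ha₀ : 0 < a) (ha₁ : a < 1)
      (ha : Real.sin (Real.pi * a) = Real.sin (Real.pi / p)) (hs : 0 < s) :
      ∫⁻ x : EuclideanSpace ℝ (Fin n), (ENNReal.ofReal (‖x‖ + s))⁻¹ * ENNReal.ofReal (‖x‖ ^ (-a))
        ∂μ = C * ENNReal.ofReal (s ^ (-a)) := by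
    have h := lintegral_inv_norm_add_mul_norm_rpow
      (volume : Measure (EuclideanSpace ℝ (Fin n))) ha₀ ha₁ hs
    rw [finrank_euclideanSpace, Fintype.card_fin, ha] at h
    rw [h, EuclideanSpace.volume_ball, hC, Fintype.card_fin, ENNReal.ofReal_one, one_pow, one_mul,
      ← ENNReal.ofReal_natCast, ← ENNReal.ofReal_mul (by positivity),
      ← ENNReal.ofReal_mul (by positivity), Real.sqrt_eq_rpow, ← Real.rpow_natCast,
      ← Real.rpow_mul Real.pi_pos.le]
    ring_nf
  set u : EuclideanSpace ℝ (Fin n) → ℝ≥0∞ := fun x ↦ ENNReal.ofReal (‖x‖ ^ (-(1 / (p * q))))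
  have hu_rpow {r r' : ℝ} (hr : 0 < r) (h : 1 / (p * q) * r = r') (x : EuclideanSpace ℝ (Fin n)) :
      u x ^ r = ENNReal.ofReal (‖x‖ ^ (-r')) := by
    rw [ENNReal.ofReal_rpow_of_nonneg (by positivity) hr.le, ← Real.rpow_mul (norm_nonneg _),
      neg_mul, h]
  have hup := hu_rpow hp₀ (r' := 1 / q) (by field_simp)
  have huq := hu_rpow hq₀ (r' := 1 / p) (by field_simp)
  have schur := lintegral_rpow_lintegral_mul_le_of_schur (μ := μ) (ν := μ) hpq
    (K := fun x y ↦ (ENNReal.ofReal (‖x‖ + ‖y‖))⁻¹) (u := u) (v := u) (A := C) (B := C)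
    (by unfold Function.uncurry; fun_prop) (by fun_prop) (by fun_prop)
    (hneμ.mono fun x hx ↦ (ENNReal.ofReal_pos.2 (by positivity)).ne')
    (.of_forall fun x ↦ ENNReal.ofReal_ne_top)
    (hneμ.mono fun y hy ↦ by
      simp_rw [huq]
      exact (radial hp_inv (by linarith) (by rw [mul_one_div]) (norm_pos_iff.2 hy)).le)
    (hneμ.mono fun x hx ↦ by
      simp_rw [hup, add_comm ‖x‖]
      exact (radial hq_inv (by linarith) (by rw [mul_one_div, hsin_conj])
        (norm_pos_iff.2 hx)).le)
    (g := fun x ↦ f x * ENNReal.ofReal (‖x‖ ^ (((n : ℝ) - 1) / p))) (by fun_prop)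
  have hinner (y : EuclideanSpace ℝ (Fin n)) : ∫⁻ x, (ENNReal.ofReal (‖x‖ + ‖y‖))⁻¹ *
      (f x * ENNReal.ofReal (‖x‖ ^ (((n : ℝ) - 1) / p))) ∂μ =
      ∫⁻ x, f x / ENNReal.ofReal (‖x‖ + ‖y‖) * ENNReal.ofReal (‖x‖ ^ ((1 - (n : ℝ)) / q)) := by
    rw [lintegral_withDensity_eq_lintegral_mul _ hw (by fun_prop)]
    refine lintegral_congr_ae (hne.mono fun x hx ↦ ?_)
    have hx' := norm_pos_iff.2 hx
    have hexp : (1 - (n : ℝ)) / q = (1 - n) + (n - 1) / p := by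
      linear_combination (1 - (n : ℝ)) * hinv
    simp only [Pi.mul_apply, w]
    rw [hexp, Real.rpow_add hx', ENNReal.ofReal_mul (by positivity), div_eq_mul_inv (f x)]
    ring
  have hnorm : ∫⁻ x, (f x * ENNReal.ofReal (‖x‖ ^ (((n : ℝ) - 1) / p))) ^ p ∂μ =
      ∫⁻ x, f x ^ p := by
    rw [lintegral_withDensity_eq_lintegral_mul _ hw (by fun_prop)]
    refine lintegral_congr_ae (hne.mono fun x hx ↦ ?_)
    have hx' := norm_pos_iff.2 hx
    simp only [Pi.mul_apply, w]
    rw [ENNReal.mul_rpow_of_nonneg _ _ hp₀.le, ENNReal.ofReal_rpow_of_nonneg (by positivity) hp₀.le,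
      ← Real.rpow_mul hx'.le, div_mul_cancel₀ _ hp₀.ne', mul_left_comm,
      ← ENNReal.ofReal_mul (by positivity), ← Real.rpow_add hx']
    simp
  have hmeas : Measurable fun y : EuclideanSpace ℝ (Fin n) ↦
      (∫⁻ x, f x / ENNReal.ofReal (‖x‖ + ‖y‖) *
      ENNReal.ofReal (‖x‖ ^ ((1 - (n : ℝ)) / q))) ^ p :=
    (Measurable.lintegral_prod_left'
      (f := fun z : EuclideanSpace ℝ (Fin n) × EuclideanSpace ℝ (Fin n) ↦
      f z.1 / ENNReal.ofReal (‖z.1‖ + ‖z.2‖) * ENNReal.ofReal (‖z.1‖ ^ ((1 - (n : ℝ)) / q)))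
      (by fun_prop)).pow_const p
  simp_rw [hinner] at schur
  rw [hnorm, lintegral_withDensity_eq_lintegral_mul _ hw hmeas] at schur
  have hCp : C ^ (p / q) * C = C ^ p := by
    nth_rewrite 2 [← ENNReal.rpow_one C]
    rw [← ENNReal.rpow_add_of_nonneg _ _ (by positivity) zero_le_one]
    congr 1
    linear_combination p * hinv - mul_one_div_cancel hp₀.ne'
  rw [hCp] at schur
  calc
    _ ≤ (C ^ p * ∫⁻ x, f x ^ p) ^ (1 / p) := by
      gcongr
      simpa only [Pi.mul_apply, mul_comm] using schur
    _ = _ := by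
      rw [ENNReal.mul_rpow_of_nonneg _ _ hp_inv.le, ← ENNReal.rpow_mul,
        mul_one_div_cancel hp₀.ne', ENNReal.rpow_one]
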